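/- Fix an alphabet size d ≥ 1 and a sequence of sparsity parameters p_N ∈ (0,1] with N·p_N → ∞ as N → ∞. For every ε ∈ (0,1), every δ ∈ (0,1), and every finite set 𝒲 of words over {1,…,d}, there exists N₀ ∈ ℕ such that for all N ≥ N₀, the sparse random model with sparsity p = p_N satisfies P( |(1/N)⟨A_I h₀, A_J h₀⟩ − δ_{I,J}| ≤ ε for all I, J ∈ 𝒲 ) ≥ 1 − δ. -/

import Mathlib

open MeasureTheory ProbabilityTheory Matrix Filter

noncomputable section

/-- Ordered product of the matrices `A i` along the word `I`
(the identity matrix for the empty word). -/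
def wordProd {d : ℕ} {n : Type*} [Fintype n] [DecidableEq n]
    (A : Fin d → Matrix n n ℝ) (I : List (Fin d)) : Matrix n n ℝ :=
  (I.map A).prod

/-- Kronecker delta of two words: `1` if `I = J`, `0` otherwise. -/
def wordDelta {d : ℕ} (I J : List (Fin d)) : ℝ := if I = J then 1 else 0

/-- The Bernoulli(p) distribution on `ℝ`: mass `p` at `1` and mass `1 - p` at `0`. -/
def bernoulliReal (p : ℝ) : Measure ℝ :=
  (Real.toNNReal p) • Measure.dirac 1 + (Real.toNNReal (1 - p)) • Measure.dirac 0

/-- Sample space of the sparse random model: the Gaussian matrices `W^i`, the Bernoulli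
masking matrices `B^i`, and the initial vector `h₀ ∈ ℝ^N`. -/
abbrev SparseOmega (d N : ℕ) : Type :=
  (Fin d → Fin N → Fin N → ℝ) × (Fin d → Fin N → Fin N → ℝ) × (Fin N → ℝ)

/-- The probability measure of the sparse random model: all entries of the `W^i` are
i.i.d. standard Gaussians, all entries of the `B^i` are i.i.d. Bernoulli(p), the entries
of `h₀` are i.i.d. standard Gaussians, and all of these are mutually independent. -/
def sparseMeasure (d N : ℕ) (p : ℝ) : Measure (SparseOmega d N) :=
  (Measure.pi fun _ : Fin d => Measure.pi fun _ : Fin N => Measure.pi fun _ : Fin N =>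
      gaussianReal 0 1).prod
    ((Measure.pi fun _ : Fin d => Measure.pi fun _ : Fin N => Measure.pi fun _ : Fin N =>
        bernoulliReal p).prod
      (Measure.pi fun _ : Fin N => gaussianReal 0 1))

/-- The channel matrices of the sparse model: `A^i = (1/√(Np)) W^i ⊙ B^i`,
where `⊙` is the entrywise (Hadamard) product. -/
def sparseA {d N : ℕ} (p : ℝ) (ω : SparseOmega d N) (i : Fin d) :
    Matrix (Fin N) (Fin N) ℝ :=
  (Real.sqrt (N * p))⁻¹ • (Matrix.of (ω.1 i) ⊙ Matrix.of (ω.2.1 i))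

/-- The random feature `A_I h₀` associated to a word `I`. -/
def sparseFeature {d N : ℕ} (p : ℝ) (I : List (Fin d)) (ω : SparseOmega d N) :
    Fin N → ℝ :=
  (wordProd (sparseA p ω) I).mulVec ω.2.2

section Walks

variable {C V : Type*}

/-- The coloured directed edges traversed by the walk starting at `v` whose successive steps
(colour, next vertex) are listed in `p`. -/
def walkEdges : V → List (C × V) → List (C × V × V)
  | _, [] => []
  | v, (c, x) :: p => (c, v, x) :: walkEdges x p

/-- The final vertex of a walk. -/
def walkEnd : V → List (C × V) → V
  | v, [] => v
  | _, (_, x) :: p => walkEnd x p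

lemma walkEdges_append (v : V) (p q : List (C × V)) :
    walkEdges v (p ++ q) = walkEdges v p ++ walkEdges (walkEnd v p) q := by
  induction p generalizing v with
  | nil => rfl
  | cons a p ih => simp [walkEdges, walkEnd, ih]

lemma walkEnd_append (v : V) (p q : List (C × V)) :
    walkEnd v (p ++ q) = walkEnd (walkEnd v p) q := by
  induction p generalizing v with
  | nil => rfl
  | cons a p ih => simp [walkEnd, ih]

lemma walkEdges_map_target (v : V) (p : List (C × V)) :
    (walkEdges v p).map (fun e => e.2.2) = p.map Prod.snd := by
  induction p generalizing v with
  | nil => rfl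
  | cons a p ih => simp [walkEdges, ih]

lemma walkEdges_length (v : V) (p : List (C × V)) : (walkEdges v p).length = p.length := by
  simpa using congrArg List.length (walkEdges_map_target v p)

/-- In an edge set where every vertex has at most one incoming edge, a walk starting from a vertex
without incoming edges is determined by its final vertex. -/
lemma walk_unique {E : Set (C × V × V)} (hE : Set.InjOn (fun e => e.2.2) E) {r r' : V}
    (hr : ∀ e ∈ E, e.2.2 ≠ r) (hr' : ∀ e ∈ E, e.2.2 ≠ r') (p q : List (C × V))
    (hp : ∀ e ∈ walkEdges r p, e ∈ E) (hq : ∀ e ∈ walkEdges r' q, e ∈ E)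
    (h : walkEnd r p = walkEnd r' q) : r = r' ∧ p = q := by
  induction p using List.reverseRecOn generalizing q with
  | nil =>
    rcases List.eq_nil_or_concat' q with rfl | ⟨q, ⟨c, x⟩, rfl⟩
    · exact ⟨h, rfl⟩
    · simp only [walkEdges_append, walkEnd_append, walkEdges, walkEnd] at h hq
      exact absurd h.symm (hr (c, walkEnd r' q, x) (hq _ (by simp)))
  | append_singleton p a ih =>
    obtain ⟨c, x⟩ := a
    simp only [walkEdges_append, walkEnd_append, walkEdges, walkEnd] at h hp
    have hx : (c, walkEnd r p, x) ∈ E := hp _ (by simp)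
    rcases List.eq_nil_or_concat' q with rfl | ⟨q, ⟨c', y⟩, rfl⟩
    · exact absurd h (hr' _ hx)
    · simp only [walkEdges_append, walkEnd_append, walkEdges, walkEnd] at h hq
      have hy : (c', walkEnd r' q, y) ∈ E := hq _ (by simp)
      have heq := hE hx hy h
      simp only [Prod.mk.injEq] at heq
      obtain ⟨h₁, h₂⟩ := ih q (fun e he => hp e (by simp [he])) (fun e he => hq e (by simp [he]))
        heq.2.1
      exact ⟨h₁, by rw [h₂, heq.1, heq.2.2]⟩

lemma exists_prefix_walkEnd {r x : V} {p : List (C × V)} (hx : x ∈ r :: p.map Prod.snd) :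
    ∃ p₁ p₂, p = p₁ ++ p₂ ∧ walkEnd r p₁ = x := by
  induction p generalizing r with
  | nil => exact ⟨[], [], rfl, by simpa [walkEnd, eq_comm] using hx⟩
  | cons a p ih =>
    rcases List.mem_cons.1 hx with rfl | hx
    · exact ⟨[], a :: p, rfl, rfl⟩
    · obtain ⟨p₁, p₂, rfl, h⟩ := ih (r := a.2) (by simpa using hx)
      exact ⟨a :: p₁, p₂, rfl, h⟩

lemma walk_nodup {E : Set (C × V × V)} (hE : Set.InjOn (fun e => e.2.2) E) {r : V}
    (hr : ∀ e ∈ E, e.2.2 ≠ r) (p : List (C × V)) (hp : ∀ e ∈ walkEdges r p, e ∈ E) :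
    (r :: p.map Prod.snd).Nodup := by
  induction p using List.reverseRecOn with
  | nil => simp
  | append_singleton p a ih =>
    have hp' := hp
    simp only [walkEdges_append] at hp'
    have hnd := ih fun e he => hp' e (by simp [he])
    have : a.2 ∉ r :: p.map Prod.snd := by
      intro ha
      obtain ⟨p₁, p₂, rfl, h⟩ := exists_prefix_walkEnd ha
      have := (walk_unique hE hr hr p₁ (p₁ ++ p₂ ++ [a])
        (fun e he => hp' e (by simp [walkEdges_append, he])) hp
        (by rw [h, walkEnd_append]; rfl)).2
      have := congrArg List.length this
      simp at this
    rw [List.map_append, ← List.cons_append]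
    exact List.Nodup.append hnd (by simp) (by simpa using this)

variable [Fintype V] [DecidableEq V] [DecidableEq C]

/-- The vertices visited by a walk after its starting point. -/
def walkVerts (p : List (C × V)) : Finset V := (p.map Prod.snd).toFinset

omit [Fintype V] [DecidableEq C] in
lemma walkVerts_cons (a : C × V) (p : List (C × V)) :
    walkVerts (a :: p) = insert a.2 (walkVerts p) := by
  simp [walkVerts]

/-- Prepending a step of colour `c` to a walk. -/
def walkCons (c : C) : V × List (C × V) ↪ List (C × V) where
  toFun a := (c, a.1) :: a.2
  inj' := by
    rintro ⟨x, p⟩ ⟨y, q⟩ h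
    simpa using h

omit [Fintype V] [DecidableEq V] [DecidableEq C] in
lemma walkCons_apply (c : C) (a : V × List (C × V)) : walkCons c a = (c, a.1) :: a.2 := rfl

/-- All walks with prescribed colour word. -/
def walks : List C → Finset (List (C × V))
  | [] => {[]}
  | c :: I => (Finset.univ ×ˢ walks I).map (walkCons c)

omit [DecidableEq V] [DecidableEq C] in
lemma sum_walks_cons {M : Type*} [AddCommMonoid M] (c : C) (I : List C)
    (f : List (C × V) → M) :
    ∑ p ∈ walks (c :: I), f p = ∑ x, ∑ p ∈ walks I, f ((c, x) :: p) := by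
  simp [walks, walkCons_apply, Finset.sum_product]

omit [DecidableEq V] [DecidableEq C] in
lemma map_fst_of_mem_walks {I : List C} {p : List (C × V)} (hp : p ∈ walks I) :
    p.map Prod.fst = I := by
  induction I generalizing p with
  | nil => simpa [walks] using hp
  | cons c I ih =>
    simp only [walks, Finset.mem_map, Finset.mem_product, Finset.mem_univ, true_and] at hp
    obtain ⟨a, ha, rfl⟩ := hp
    simp [walkCons_apply, ih ha]

omit [DecidableEq V] [DecidableEq C] in
lemma length_of_mem_walks {I : List C} {p : List (C × V)} (hp : p ∈ walks I) :
    p.length = I.length := by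
  simpa using congrArg List.length (map_fst_of_mem_walks hp)

omit [DecidableEq V] [DecidableEq C] in
lemma card_walks (I : List C) : (walks I : Finset (List (C × V))).card
    = Fintype.card V ^ I.length := by
  induction I with
  | nil => simp [walks]
  | cons c I ih => simp [walks, ih, pow_succ, mul_comm]

/-- The weight `|V|^{-|S|}` of a set of vertices. -/
def vertWeight (S : Finset V) : ℝ := ((Fintype.card V : ℝ)⁻¹) ^ S.card

omit [DecidableEq V] in
lemma vertWeight_nonneg (S : Finset V) : 0 ≤ vertWeight S := by
  unfold vertWeight; positivity

lemma sum_vertWeight_insert_le (S : Finset V) :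
    ∑ x, vertWeight (insert x S) ≤ (1 + S.card) * vertWeight S := by
  rw [← Finset.sum_add_sum_compl S, add_mul, one_mul, add_comm (vertWeight S)]
  refine add_le_add ?_ ?_
  · rw [Finset.sum_congr rfl fun x hx => by rw [Finset.insert_eq_of_mem hx]]
    simp
  · rw [Finset.sum_congr rfl fun x hx => show vertWeight (insert x S)
      = vertWeight S * (Fintype.card V : ℝ)⁻¹ by
        rw [vertWeight, Finset.card_insert_of_notMem (Finset.mem_compl.1 hx), pow_succ]; rfl]
    rw [Finset.sum_const, nsmul_eq_mul, mul_left_comm]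
    refine mul_le_of_le_one_right (vertWeight_nonneg S) ?_
    rw [← div_eq_mul_inv]
    exact div_le_one_of_le₀ (by exact_mod_cast Finset.card_le_univ _) (by positivity)

omit [DecidableEq C] in
lemma sum_walks_vertWeight_le (I : List C) (S : Finset V) (L : ℕ) (hL : S.card + I.length ≤ L) :
    ∑ p ∈ walks I, vertWeight (S ∪ walkVerts p) ≤ (1 + L) ^ I.length * vertWeight S := by
  induction I generalizing S with
  | nil => simp [walks, walkVerts]
  | cons c I ih =>
    simp only [List.length_cons] at hL
    rw [sum_walks_cons]
    calc ∑ x, ∑ p ∈ walks I, vertWeight (S ∪ walkVerts ((c, x) :: p))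
        = ∑ x, ∑ p ∈ walks I, vertWeight (insert x S ∪ walkVerts p) := by
          simp [walkVerts_cons, Finset.insert_union]
      _ ≤ ∑ x, (1 + L) ^ I.length * vertWeight (insert x S) := by
          refine Finset.sum_le_sum fun x _ => ih _ ?_
          have := Finset.card_insert_le x S
          omega
      _ ≤ (1 + L) ^ I.length * ((1 + S.card) * vertWeight S) := by
          rw [← Finset.mul_sum]
          gcongr
          exact sum_vertWeight_insert_le S
      _ ≤ (1 + L) ^ (I.length + 1) * vertWeight S := by
          rw [pow_succ, mul_assoc]
          have := vertWeight_nonneg S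
          have : (S.card : ℝ) ≤ L := by exact_mod_cast (by omega : S.card ≤ L)
          gcongr

/-! ### Pairs of walks with a common starting point -/

/-- Edges traversed by a pair of walks with a common starting point. -/
def pairEdges (s : V × List (C × V) × List (C × V)) : List (C × V × V) :=
  walkEdges s.1 s.2.1 ++ walkEdges s.1 s.2.2

/-- Final vertices of a pair of walks with a common starting point. -/
def pairEnds (s : V × List (C × V) × List (C × V)) : List V :=
  [walkEnd s.1 s.2.1, walkEnd s.1 s.2.2]

/-- Vertices visited by a pair of walks with a common starting point. -/
def pairVerts (s : V × List (C × V) × List (C × V)) : Finset V :=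
  insert s.1 (walkVerts s.2.1 ∪ walkVerts s.2.2)

/-- Pairs of walks with a common starting point and prescribed colour words. -/
def walkPairs (I J : List C) : Finset (V × List (C × V) × List (C × V)) :=
  Finset.univ ×ˢ walks I ×ˢ walks J

omit [DecidableEq C] in
lemma sum_walkPairs_vertWeight_le (I J : List C) (S : Finset V) (L : ℕ)
    (hL : S.card + (1 + I.length + J.length) ≤ L) :
    ∑ s ∈ walkPairs I J, vertWeight (S ∪ pairVerts s)
      ≤ (1 + L) ^ (1 + I.length + J.length) * vertWeight S := by
  have hins : ∀ v, (insert v S).card ≤ S.card + 1 := fun v => Finset.card_insert_le v S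
  have hverts : ∀ p ∈ (walks I : Finset (List (C × V))), (walkVerts p).card ≤ I.length := by
    intro p hp
    rw [← length_of_mem_walks hp, ← List.length_map (f := Prod.snd) (as := p)]
    exact List.toFinset_card_le _
  calc ∑ s ∈ walkPairs I J, vertWeight (S ∪ pairVerts s)
      = ∑ v, ∑ p ∈ walks I, ∑ q ∈ walks J,
          vertWeight ((insert v S ∪ walkVerts p) ∪ walkVerts q) := by
        simp [walkPairs, pairVerts, Finset.sum_product, Finset.insert_union]
    _ ≤ ∑ v, ∑ p ∈ walks (C := C) I,
          (1 + L) ^ J.length * vertWeight (insert v S ∪ walkVerts p) := by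
        refine Finset.sum_le_sum fun v _ => Finset.sum_le_sum fun p hp =>
          sum_walks_vertWeight_le _ _ _ ?_
        have h₁ := hins v
        have h₂ := hverts p hp
        have h₃ := Finset.card_union_le (insert v S) (walkVerts p)
        omega
    _ ≤ ∑ v, (1 + L) ^ J.length * ((1 + L) ^ I.length * vertWeight (insert v S)) := by
        refine Finset.sum_le_sum fun v _ => ?_
        rw [← Finset.mul_sum]
        gcongr
        refine sum_walks_vertWeight_le _ _ _ ?_
        have h₁ := hins v
        omega
    _ ≤ (1 + L) ^ J.length * ((1 + L) ^ I.length * ((1 + S.card) * vertWeight S)) := by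
        rw [← Finset.mul_sum, ← Finset.mul_sum]
        gcongr
        exact sum_vertWeight_insert_le S
    _ ≤ (1 + L) ^ J.length * ((1 + L) ^ I.length * ((1 + L) * vertWeight S)) := by
        have := vertWeight_nonneg S
        have : (S.card : ℝ) ≤ L := by exact_mod_cast (by omega : S.card ≤ L)
        gcongr
    _ = (1 + L) ^ (1 + I.length + J.length) * vertWeight S := by ring

omit [Fintype V] in
lemma pairVerts_eq (s : V × List (C × V) × List (C × V)) :
    pairVerts s = {s.1} ∪ (pairEdges s).toFinset.image (fun e => e.2.2) := by
  ext x
  have h : ∀ p : List (C × V), (∃ e ∈ walkEdges s.1 p, e.2.2 = x) ↔ x ∈ walkVerts p := by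
    intro p
    rw [walkVerts, ← walkEdges_map_target s.1 p]
    simp
  simp only [pairVerts, pairEdges, Finset.mem_insert, Finset.mem_union, ← h, List.mem_toFinset,
    Finset.mem_image, Finset.mem_singleton, List.mem_append, or_and_right, exists_or]

omit [Fintype V] [DecidableEq C] in
/-- If the number of vertices is maximal given the number of edges, then every vertex has at most
one incoming edge, and the roots have none. -/
lemma forest_of_card_le (R : Finset V) (E : Finset (C × V × V))
    (h : R.card + E.card ≤ (R ∪ E.image fun e => e.2.2).card) :
    Set.InjOn (fun e => e.2.2) (E : Set (C × V × V)) ∧ ∀ r ∈ R, ∀ e ∈ E, e.2.2 ≠ r := by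
  have h₁ := Finset.card_union_add_card_inter R (E.image fun e => e.2.2)
  have h₂ := Finset.card_image_le (s := E) (f := fun e => e.2.2)
  refine ⟨Finset.card_image_iff.1 (by omega), fun r hr e he her => ?_⟩
  have h₃ : r ∈ R ∩ E.image fun e => e.2.2 :=
    Finset.mem_inter.2 ⟨hr, Finset.mem_image.2 ⟨e, he, her⟩⟩
  have := Finset.card_pos.2 ⟨r, h₃⟩
  omega

omit [Fintype V] [DecidableEq C] in
lemma exists_walk_of_mem_pairVerts {s : V × List (C × V) × List (C × V)} {x : V}
    (hx : x ∈ pairVerts s) :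
    ∃ p, (∀ e ∈ walkEdges s.1 p, e ∈ pairEdges s) ∧ walkEnd s.1 p = x := by
  have : x ∈ s.1 :: s.2.1.map Prod.snd ∨ x ∈ s.1 :: s.2.2.map Prod.snd := by
    simp only [pairVerts, walkVerts, Finset.mem_insert, Finset.mem_union, List.mem_toFinset] at hx
    simp only [List.mem_cons]
    tauto
  rcases this with h | h
  · obtain ⟨p₁, p₂, h₁, h₂⟩ := exists_prefix_walkEnd h
    exact ⟨p₁, fun e he => by simp [pairEdges, h₁, walkEdges_append, he], h₂⟩
  · obtain ⟨p₁, p₂, h₁, h₂⟩ := exists_prefix_walkEnd h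
    exact ⟨p₁, fun e he => by simp [pairEdges, h₁, walkEdges_append, he], h₂⟩

omit [Fintype V] in
lemma card_pairVerts_union_le (s t : V × List (C × V) × List (C × V))
    (h : ¬ Disjoint (pairVerts s) (pairVerts t)) :
    (pairVerts s ∪ pairVerts t).card ≤ (pairEdges s ++ pairEdges t).toFinset.card + 1 := by
  by_contra! hlt
  set E := (pairEdges s ++ pairEdges t).toFinset
  have hV : pairVerts s ∪ pairVerts t = {s.1, t.1} ∪ E.image fun e => e.2.2 := by
    rw [pairVerts_eq, pairVerts_eq, show E = _ from List.toFinset_append, Finset.image_union]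
    ext x
    simp only [Finset.mem_union, Finset.mem_insert, Finset.mem_singleton]
    tauto
  rw [hV] at hlt
  obtain ⟨x, hxs, hxt⟩ := Finset.not_disjoint_iff.1 h
  obtain ⟨p, hp, hpx⟩ := exists_walk_of_mem_pairVerts hxs
  obtain ⟨q, hq, hqx⟩ := exists_walk_of_mem_pairVerts hxt
  have h₂ : ({s.1, t.1} : Finset V).card ≤ 2 := Finset.card_le_two
  obtain ⟨hinj, hroot⟩ := forest_of_card_le {s.1, t.1} E (by omega)
  have heq : s.1 = t.1 := (walk_unique hinj (hroot _ (by simp)) (hroot _ (by simp)) p q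
    (fun e he => by simp [E, hp e he]) (fun e he => by simp [E, hq e he])
    (hpx.trans hqx.symm)).1
  have h₃ := Finset.card_union_le {s.1, t.1} (E.image fun e => e.2.2)
  have h₄ := Finset.card_image_le (s := E) (f := fun e => e.2.2)
  have h₅ : ({s.1, t.1} : Finset V).card = 1 := by simp [heq]
  omega

end Walks

section Moments

variable {C V : Type*} [Fintype C] [Fintype V] [DecidableEq C] [DecidableEq V]

/-- The product over all letters `a` of `f` evaluated at the multiplicity of `a` in a list. -/
def countProd {α : Type*} [Fintype α] [DecidableEq α] (f : ℕ → ℝ) (l : List α) : ℝ :=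
  ∏ a, f (l.count a)

/-- The expectation of a monomial in independent edge and vertex variables, where `μ k` and `γ k`
are the `k`-th moments of the edge and vertex variables. -/
def mixedMoment (μ γ : ℕ → ℝ) (E : List (C × V × V)) (H : List V) : ℝ :=
  countProd μ E * countProd γ H

/-- Normalisation and size of the moments, up to order `L`, of edge variables of variance `n⁻¹` and
vertex variables of variance `1`. -/
structure MomentBounds (n : ℝ) (μ γ : ℕ → ℝ) (L : ℕ) (G : ℝ) : Prop where
  edge_zero : μ 0 = 1
  edge_two : μ 2 = n⁻¹
  edge_le : ∀ k, 1 ≤ k → k ≤ L → |μ k| ≤ G * n⁻¹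
  vert_zero : γ 0 = 1
  vert_one : γ 1 = 0
  vert_two : γ 2 = 1
  vert_le : ∀ k ≤ L, |γ k| ≤ G
  one_le : 1 ≤ G

lemma countProd_eq {α : Type*} [Fintype α] [DecidableEq α] {f : ℕ → ℝ} (h0 : f 0 = 1)
    (l : List α) : countProd f l = ∏ a ∈ l.toFinset, f (l.count a) := by
  refine (Finset.prod_subset (Finset.subset_univ _) fun a _ ha => ?_).symm
  rw [List.count_eq_zero_of_not_mem (by simpa using ha), h0]

lemma abs_countProd_le {α : Type*} [Fintype α] [DecidableEq α] {f : ℕ → ℝ} {c : ℝ} {L : ℕ}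
    (h0 : f 0 = 1) (hf : ∀ k, 1 ≤ k → k ≤ L → |f k| ≤ c) (l : List α) (hl : l.length ≤ L) :
    |countProd f l| ≤ c ^ l.toFinset.card := by
  rw [countProd_eq h0, Finset.abs_prod, ← Finset.prod_const]
  refine Finset.prod_le_prod (fun _ _ => abs_nonneg _) fun a ha => hf _ ?_ ?_
  · exact List.count_pos_iff.2 (by simpa using ha)
  · exact List.count_le_length.trans hl

lemma countProd_append {α : Type*} [Fintype α] [DecidableEq α] {f : ℕ → ℝ} (h0 : f 0 = 1)
    (l l' : List α) (h : ∀ a ∈ l, a ∉ l') :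
    countProd f (l ++ l') = countProd f l * countProd f l' := by
  rw [countProd, countProd, countProd, ← Finset.prod_mul_distrib]
  refine Finset.prod_congr rfl fun a _ => ?_
  rw [List.count_append]
  by_cases ha : a ∈ l
  · rw [List.count_eq_zero_of_not_mem (h a ha), h0]; simp
  · rw [List.count_eq_zero_of_not_mem ha, h0]; simp

lemma count_append_self {α : Type*} [DecidableEq α] {l : List α} (hl : l.Nodup) {a : α}
    (ha : a ∈ l) : (l ++ l).count a = 2 := by
  rw [List.count_append, List.count_eq_one_of_mem hl ha]

variable {μ γ : ℕ → ℝ} {L : ℕ} {G : ℝ}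

lemma abs_mixedMoment_le (hM : MomentBounds (Fintype.card V) μ γ L G) (E : List (C × V × V))
    (H : List V) (hE : E.length ≤ L) (hH : H.length ≤ L) :
    |mixedMoment μ γ E H| ≤ G ^ (2 * L) * ((Fintype.card V : ℝ)⁻¹) ^ E.toFinset.card := by
  have hG := hM.one_le
  rw [mixedMoment, abs_mul]
  calc _ ≤ (G * (Fintype.card V : ℝ)⁻¹) ^ E.toFinset.card * G ^ H.toFinset.card := by
        gcongr
        · exact abs_countProd_le hM.edge_zero hM.edge_le E hE
        · exact abs_countProd_le hM.vert_zero (fun k _ hk => hM.vert_le k hk) H hH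
    _ ≤ (G ^ L * ((Fintype.card V : ℝ)⁻¹) ^ E.toFinset.card) * G ^ L := by
        rw [mul_pow]
        gcongr
        · exact (List.toFinset_card_le E).trans hE
        · exact (List.toFinset_card_le H).trans hH
    _ = _ := by ring

omit [Fintype C] [DecidableEq C] [DecidableEq V] in
lemma inv_pow_le_mul_vertWeight [Nonempty V] (S : Finset V) (k : ℕ) (h : S.card ≤ k + 1) :
    ((Fintype.card V : ℝ)⁻¹) ^ k ≤ Fintype.card V * vertWeight S := by
  have hn : (0 : ℝ) < Fintype.card V := by exact_mod_cast Fintype.card_pos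
  have h1 : (1 : ℝ) ≤ Fintype.card V := by exact_mod_cast Fintype.card_pos
  calc ((Fintype.card V : ℝ)⁻¹) ^ k
      = Fintype.card V * ((Fintype.card V : ℝ)⁻¹) ^ (k + 1) := by
        rw [pow_succ]; field_simp
    _ ≤ Fintype.card V * vertWeight S := by
        refine mul_le_mul_of_nonneg_left ?_ hn.le
        exact pow_le_pow_of_le_one (by positivity) (inv_le_one_of_one_le₀ h1) h

omit [Fintype C] [Fintype V] [DecidableEq C] in
lemma mem_pairVerts_of_mem_edges {s : V × List (C × V) × List (C × V)} {e : C × V × V}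
    (he : e ∈ pairEdges s) : e.2.2 ∈ pairVerts s := by
  classical
  rw [pairVerts_eq]
  exact Finset.mem_union_right _ (Finset.mem_image.2 ⟨e, by simpa using he, rfl⟩)

omit [Fintype C] [Fintype V] [DecidableEq C] in
lemma walkEnd_mem (v : V) (p : List (C × V)) : walkEnd v p ∈ insert v (walkVerts p) := by
  induction p generalizing v with
  | nil => simp [walkEnd]
  | cons a p ih =>
    rw [walkVerts_cons]
    exact Finset.mem_insert_of_mem (ih a.2)

omit [Fintype C] [Fintype V] [DecidableEq C] in
lemma mem_pairVerts_of_mem_ends {s : V × List (C × V) × List (C × V)} {x : V}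
    (hx : x ∈ pairEnds s) : x ∈ pairVerts s := by
  simp only [pairEnds, List.mem_cons, List.not_mem_nil, or_false] at hx
  have h₁ := walkEnd_mem s.1 s.2.1
  have h₂ := walkEnd_mem s.1 s.2.2
  simp only [pairVerts, Finset.mem_insert, Finset.mem_union] at *
  rcases hx with rfl | rfl <;> tauto

/-- Decorrelation: the covariance of the monomials attached to two pairs of walks. -/
lemma abs_mixedMoment_sub_mul_le [Nonempty V] (hM : MomentBounds (Fintype.card V) μ γ L G)
    (s t : V × List (C × V) × List (C × V))
    (hE : (pairEdges s ++ pairEdges t).length ≤ L) (hL : 4 ≤ L) :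
    |mixedMoment μ γ (pairEdges s ++ pairEdges t) (pairEnds s ++ pairEnds t)
        - mixedMoment μ γ (pairEdges s) (pairEnds s) * mixedMoment μ γ (pairEdges t) (pairEnds t)|
      ≤ Fintype.card V * (2 * G ^ (4 * L) * vertWeight (pairVerts s ∪ pairVerts t)) := by
  have hG := hM.one_le
  have hw := vertWeight_nonneg (pairVerts s ∪ pairVerts t)
  have h1 : (1 : ℝ) ≤ Fintype.card V := by exact_mod_cast Fintype.card_pos
  by_cases h : Disjoint (pairVerts s) (pairVerts t)
  · rw [Finset.disjoint_left] at h
    have : mixedMoment μ γ (pairEdges s ++ pairEdges t) (pairEnds s ++ pairEnds t)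
        = mixedMoment μ γ (pairEdges s) (pairEnds s)
          * mixedMoment μ γ (pairEdges t) (pairEnds t) := by
      rw [mixedMoment, countProd_append hM.edge_zero, countProd_append hM.vert_zero, mixedMoment,
        mixedMoment]
      · ring
      · exact fun x hx hx' => h (mem_pairVerts_of_mem_ends hx) (mem_pairVerts_of_mem_ends hx')
      · exact fun e he he' => h (mem_pairVerts_of_mem_edges he) (mem_pairVerts_of_mem_edges he')
    rw [this, sub_self, abs_zero]
    positivity
  · set c := (pairEdges s ++ pairEdges t).toFinset.card with hc
    have hcard := card_pairVerts_union_le s t h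
    have hsub : c ≤ (pairEdges s).toFinset.card + (pairEdges t).toFinset.card := by
      rw [hc, List.toFinset_append]
      exact Finset.card_union_le _ _
    rw [List.length_append] at hE
    have h₁ := abs_mixedMoment_le hM (pairEdges s ++ pairEdges t) (pairEnds s ++ pairEnds t)
      (by rw [List.length_append]; exact hE) (by simpa [pairEnds] using hL)
    have h₂ := abs_mixedMoment_le hM (pairEdges s) (pairEnds s) (by omega)
      (by simp [pairEnds]; omega)
    have h₃ := abs_mixedMoment_le hM (pairEdges t) (pairEnds t) (by omega)
      (by simp [pairEnds]; omega)
    rw [← hc] at h₁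
    have h₄ := inv_pow_le_mul_vertWeight (pairVerts s ∪ pairVerts t) c hcard
    have h₅ : ((Fintype.card V : ℝ)⁻¹) ^ ((pairEdges s).toFinset.card
        + (pairEdges t).toFinset.card) ≤ ((Fintype.card V : ℝ)⁻¹) ^ c :=
      pow_le_pow_of_le_one (by positivity) (inv_le_one_of_one_le₀ h1) hsub
    have h₆ : G ^ (2 * L) ≤ G ^ (4 * L) := pow_le_pow_right₀ hG (by omega)
    calc _ ≤ G ^ (2 * L) * ((Fintype.card V : ℝ)⁻¹) ^ c
          + (G ^ (2 * L) * ((Fintype.card V : ℝ)⁻¹) ^ (pairEdges s).toFinset.card)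
            * (G ^ (2 * L) * ((Fintype.card V : ℝ)⁻¹) ^ (pairEdges t).toFinset.card) := by
          refine (abs_sub _ _).trans (add_le_add h₁ ?_)
          rw [abs_mul]
          gcongr
      _ = G ^ (2 * L) * ((Fintype.card V : ℝ)⁻¹) ^ c
          + G ^ (4 * L) * ((Fintype.card V : ℝ)⁻¹) ^ ((pairEdges s).toFinset.card
              + (pairEdges t).toFinset.card) := by ring
      _ ≤ G ^ (4 * L) * (Fintype.card V * vertWeight (pairVerts s ∪ pairVerts t))
          + G ^ (4 * L) * (Fintype.card V * vertWeight (pairVerts s ∪ pairVerts t)) := by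
          gcongr
          exact h₅.trans h₄
      _ = _ := by ring

/-- The monomial attached to a self-avoiding walk paired with itself. -/
lemma mixedMoment_diag (hM : MomentBounds (Fintype.card V) μ γ L G) (v : V) (p : List (C × V))
    (h : (v :: p.map Prod.snd).Nodup) :
    mixedMoment μ γ (pairEdges (v, p, p)) (pairEnds (v, p, p))
      = ((Fintype.card V : ℝ)⁻¹) ^ p.length := by
  have hnd : (walkEdges v p).Nodup := by
    refine List.Nodup.of_map (fun e => e.2.2) ?_
    rw [walkEdges_map_target]
    exact (List.nodup_cons.1 h).2
  have h₁ : countProd μ (pairEdges (v, p, p))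
      = ∏ e ∈ (walkEdges v p).toFinset, (Fintype.card V : ℝ)⁻¹ := by
    rw [countProd_eq hM.edge_zero]
    refine Finset.prod_congr (by simp [pairEdges]) fun e he => ?_
    have : e ∈ walkEdges v p := by simpa [pairEdges] using he
    dsimp only [pairEdges]
    rw [count_append_self hnd this, hM.edge_two]
  have h₂ : countProd γ (pairEnds (v, p, p)) = 1 := by
    rw [countProd_eq hM.vert_zero]
    simp [pairEnds, hM.vert_two]
  rw [mixedMoment, h₁, h₂, Finset.prod_const, List.toFinset_card_of_nodup hnd, walkEdges_length, mul_one]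

lemma mixedMoment_eq_zero (hM : MomentBounds (Fintype.card V) μ γ L G)
    (s : V × List (C × V) × List (C × V)) (h : walkEnd s.1 s.2.1 ≠ walkEnd s.1 s.2.2) :
    mixedMoment μ γ (pairEdges s) (pairEnds s) = 0 := by
  rw [mixedMoment, mul_eq_zero]
  refine Or.inr (Finset.prod_eq_zero (Finset.mem_univ (walkEnd s.1 s.2.1)) ?_)
  rw [pairEnds, List.count_cons_self, List.count_eq_zero_of_not_mem (by simpa using h)]
  exact hM.vert_one

/-- Only self-avoiding walks paired with themselves contribute to the mean at leading order. -/
lemma abs_mixedMoment_sub_ite_le [Nonempty V] (hM : MomentBounds (Fintype.card V) μ γ L G)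
    (s : V × List (C × V) × List (C × V))
    (hE : (pairEdges s).length ≤ L) (hL : 2 ≤ L) :
    |mixedMoment μ γ (pairEdges s) (pairEnds s)
        - if s.2.1 = s.2.2 then ((Fintype.card V : ℝ)⁻¹) ^ s.2.1.length else 0|
      ≤ (G ^ (2 * L) + 1) * vertWeight (pairVerts s) := by
  obtain ⟨v, p, q⟩ := s
  have hG := hM.one_le
  have hw := vertWeight_nonneg (pairVerts (v, p, q))
  have h1 : (1 : ℝ) ≤ Fintype.card V := by exact_mod_cast Fintype.card_pos
  have hinv := inv_le_one_of_one_le₀ h1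
  by_cases hcard : (pairVerts (v, p, q)).card ≤ (pairEdges (v, p, q)).toFinset.card
  · have h₁ : |mixedMoment μ γ (pairEdges (v, p, q)) (pairEnds (v, p, q))|
        ≤ G ^ (2 * L) * vertWeight (pairVerts (v, p, q)) := by
      refine (abs_mixedMoment_le hM _ _ hE (by simpa [pairEnds] using hL)).trans ?_
      unfold vertWeight
      gcongr ?_ * ?_
      exact pow_le_pow_of_le_one (by positivity) hinv hcard
    have h₂ : |if p = q then ((Fintype.card V : ℝ)⁻¹) ^ p.length else 0|
        ≤ vertWeight (pairVerts (v, p, q)) := by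
      split_ifs with hpq
      · subst hpq
        rw [abs_of_nonneg (by positivity)]
        refine pow_le_pow_of_le_one (by positivity) hinv (hcard.trans ?_)
        rw [pairEdges, List.toFinset_append, Finset.union_self, ← walkEdges_length v p]
        exact List.toFinset_card_le _
      · simpa using hw
    refine (abs_sub _ _).trans ((add_le_add h₁ h₂).trans_eq ?_)
    ring
  · rw [pairVerts_eq] at hcard
    dsimp only at hcard
    obtain ⟨hinj, hroot⟩ := forest_of_card_le {v} (pairEdges (v, p, q)).toFinset
      (by rw [Finset.card_singleton]; omega)
    have hroot := hroot v (by simp)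
    have hp : ∀ e ∈ walkEdges v p, e ∈ (pairEdges (v, p, q)).toFinset :=
      fun e he => by simp [pairEdges, he]
    have hq : ∀ e ∈ walkEdges v q, e ∈ (pairEdges (v, p, q)).toFinset :=
      fun e he => by simp [pairEdges, he]
    have : mixedMoment μ γ (pairEdges (v, p, q)) (pairEnds (v, p, q))
        = if p = q then ((Fintype.card V : ℝ)⁻¹) ^ p.length else 0 := by
      split_ifs with hpq
      · subst hpq
        exact mixedMoment_diag hM v p (walk_nodup hinj hroot p hp)
      · exact mixedMoment_eq_zero hM _ fun h =>
          hpq (walk_unique hinj hroot hroot p q hp hq h).2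
    simp only [this, sub_self, abs_zero]
    positivity

omit [Fintype C] in
lemma sum_walkPairs_ite [Nonempty V] (I J : List C) :
    ∑ s ∈ walkPairs (V := V) I J,
        (if s.2.1 = s.2.2 then ((Fintype.card V : ℝ)⁻¹) ^ s.2.1.length else 0)
      = Fintype.card V * if I = J then 1 else 0 := by
  have hn : (Fintype.card V : ℝ) ≠ 0 := by exact_mod_cast Fintype.card_ne_zero
  simp only [walkPairs, Finset.sum_product]
  split_ifs with h
  · subst h
    have : ∀ p ∈ walks (V := V) I, ∑ q ∈ walks (V := V) I,
        (if p = q then ((Fintype.card V : ℝ)⁻¹) ^ p.length else 0)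
          = ((Fintype.card V : ℝ)⁻¹) ^ I.length := by
      intro p hp
      rw [Finset.sum_ite_eq, if_pos hp, length_of_mem_walks hp]
    rw [Finset.sum_congr rfl fun v _ => Finset.sum_congr rfl this]
    simp only [Finset.sum_const, card_walks, nsmul_eq_mul, Nat.cast_pow, Finset.card_univ]
    rw [← mul_pow, mul_inv_cancel₀ hn, one_pow]
  · rw [mul_zero]
    refine Finset.sum_eq_zero fun v _ => Finset.sum_eq_zero fun p hp =>
      Finset.sum_eq_zero fun q hq => if_neg ?_
    rintro rfl
    exact h ((map_fst_of_mem_walks hp).symm.trans (map_fst_of_mem_walks hq))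

omit [Fintype C] [DecidableEq C] [DecidableEq V] in
lemma length_pairEdges {I J : List C} {s : V × List (C × V) × List (C × V)}
    (hs : s ∈ walkPairs I J) : (pairEdges s).length = I.length + J.length := by
  simp only [walkPairs, Finset.mem_product, Finset.mem_univ, true_and] at hs
  rw [pairEdges, List.length_append, walkEdges_length, walkEdges_length,
    length_of_mem_walks hs.1, length_of_mem_walks hs.2]

/-- Quantitative bound for the mean square deviation, in terms of mixed moments. -/
lemma mixedMoment_deviation_le [Nonempty V] (I J : List C)
    (hM : MomentBounds (Fintype.card V) μ γ L G) (hL : 2 * (1 + I.length + J.length) + 2 ≤ L) :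
    ((Fintype.card V : ℝ)⁻¹) ^ 2 * ∑ s ∈ walkPairs (V := V) I J, ∑ t ∈ walkPairs (V := V) I J,
          mixedMoment μ γ (pairEdges s ++ pairEdges t) (pairEnds s ++ pairEnds t)
        - 2 * (if I = J then 1 else 0) * ((Fintype.card V : ℝ)⁻¹
          * ∑ s ∈ walkPairs (V := V) I J, mixedMoment μ γ (pairEdges s) (pairEnds s))
        + (if I = J then 1 else 0) ^ 2
      ≤ (2 * G ^ (4 * L) * ((1 + L) ^ (1 + I.length + J.length)) ^ 2
          + ((G ^ (2 * L) + 1) * (1 + L) ^ (1 + I.length + J.length)) ^ 2)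
        * (Fintype.card V : ℝ)⁻¹ := by
  have hG := hM.one_le
  have h1 : (1 : ℝ) ≤ Fintype.card V := by exact_mod_cast Fintype.card_pos
  set n : ℝ := (Fintype.card V : ℝ)
  set B : ℝ := (1 + L) ^ (1 + I.length + J.length) with hB
  have hB0 : 0 ≤ B := by positivity
  set P := walkPairs (V := V) I J
  set δ : ℝ := if I = J then 1 else 0 with hδ
  set m := fun s : V × List (C × V) × List (C × V) => mixedMoment μ γ (pairEdges s) (pairEnds s)
  set m₂ := fun s t : V × List (C × V) × List (C × V) =>
    mixedMoment μ γ (pairEdges s ++ pairEdges t) (pairEnds s ++ pairEnds t)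
  have hlen : ∀ s ∈ P, (pairEdges s).length = I.length + J.length :=
    fun s hs => length_pairEdges hs
  have hw : ∑ s ∈ P, vertWeight (pairVerts s) ≤ B := by
    simpa [vertWeight] using sum_walkPairs_vertWeight_le I J (∅ : Finset V) L (by simp; omega)
  have hverts : ∀ s ∈ P, (pairVerts s).card ≤ 1 + I.length + J.length := by
    intro s hs
    rw [pairVerts_eq]
    have h₁ := Finset.card_union_le {s.1} ((pairEdges s).toFinset.image fun e => e.2.2)
    have h₂ := Finset.card_image_le (s := (pairEdges s).toFinset) (f := fun e => e.2.2)
    have h₃ := List.toFinset_card_le (pairEdges s)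
    have h₄ := hlen s hs
    rw [Finset.card_singleton] at h₁
    omega
  have hw₂ : ∑ s ∈ P, ∑ t ∈ P, vertWeight (pairVerts s ∪ pairVerts t) ≤ B ^ 2 := by
    calc _ ≤ ∑ s ∈ P, B * vertWeight (pairVerts s) := by
          refine Finset.sum_le_sum fun s hs => sum_walkPairs_vertWeight_le I J _ L ?_
          have := hverts s hs
          omega
      _ ≤ B * B := by rw [← Finset.mul_sum]; gcongr
      _ = B ^ 2 := (sq B).symm
  have hvar : ∑ s ∈ P, ∑ t ∈ P, m₂ s t - (∑ s ∈ P, m s) ^ 2 ≤ n * (2 * G ^ (4 * L) * B ^ 2) := by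
    rw [sq, Finset.sum_mul_sum, ← Finset.sum_sub_distrib]
    calc _ ≤ ∑ s ∈ P, ∑ t ∈ P, n * (2 * G ^ (4 * L) * vertWeight (pairVerts s ∪ pairVerts t)) := by
          refine Finset.sum_le_sum fun s hs => ?_
          rw [← Finset.sum_sub_distrib]
          refine Finset.sum_le_sum fun t ht => (le_abs_self _).trans
            (abs_mixedMoment_sub_mul_le hM s t ?_ (by omega))
          rw [List.length_append, hlen s hs, hlen t ht]
          omega
      _ = n * (2 * G ^ (4 * L) * ∑ s ∈ P, ∑ t ∈ P, vertWeight (pairVerts s ∪ pairVerts t)) := by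
          simp only [Finset.mul_sum]
      _ ≤ _ := by gcongr
  have hmean : |∑ s ∈ P, m s - n * δ| ≤ (G ^ (2 * L) + 1) * B := by
    rw [hδ, ← sum_walkPairs_ite, ← Finset.sum_sub_distrib]
    refine (Finset.abs_sum_le_sum_abs _ _).trans ?_
    calc _ ≤ ∑ s ∈ P, (G ^ (2 * L) + 1) * vertWeight (pairVerts s) :=
          Finset.sum_le_sum fun s hs => abs_mixedMoment_sub_ite_le hM s
            (by rw [hlen s hs]; omega) (by omega)
      _ ≤ _ := by rw [← Finset.mul_sum]; gcongr
  set S₁ := ∑ s ∈ P, m s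
  set S₂ := ∑ s ∈ P, ∑ t ∈ P, m₂ s t
  have hn : n ≠ 0 := by positivity
  have hsq := pow_le_pow_left₀ (abs_nonneg _) hmean 2
  rw [sq_abs] at hsq
  have hinv : (n⁻¹) ^ 2 ≤ n⁻¹ :=
    pow_le_of_le_one (by positivity) (inv_le_one_of_one_le₀ h1) two_ne_zero
  calc n⁻¹ ^ 2 * S₂ - 2 * δ * (n⁻¹ * S₁) + δ ^ 2
      = n⁻¹ ^ 2 * (S₂ - S₁ ^ 2) + n⁻¹ ^ 2 * (S₁ - n * δ) ^ 2 := by field_simp; ring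
    _ ≤ n⁻¹ ^ 2 * (n * (2 * G ^ (4 * L) * B ^ 2)) + n⁻¹ * ((G ^ (2 * L) + 1) * B) ^ 2 := by
        gcongr
    _ = _ := by field_simp

end Moments

section Probability

/-- The moments of the standard Gaussian distribution. -/
def gaussianMoment (k : ℕ) : ℝ := ∫ x, x ^ k ∂gaussianReal 0 1

/-- The moments of an entry `(1/√(Np)) W ⊙ B` of the sparse matrices. -/
def sparseEntryMoment (N : ℕ) (p : ℝ) (k : ℕ) : ℝ :=
  (Real.sqrt (N * p))⁻¹ ^ k * (gaussianMoment k * ∫ x, x ^ k ∂bernoulliReal p)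

lemma integrable_pow_gaussianReal (k : ℕ) :
    Integrable (fun x : ℝ => x ^ k) (gaussianReal 0 1) := by
  have h : MemLp id (k : ENNReal) (gaussianReal 0 1) :=
    memLp_id_gaussianReal' _ (ENNReal.natCast_ne_top k)
  have := h.integrable_norm_pow'
  refine this.mono' (by fun_prop) (Filter.Eventually.of_forall fun x => by simp)

lemma gaussianMoment_zero : gaussianMoment 0 = 1 := by simp [gaussianMoment]

lemma gaussianMoment_one : gaussianMoment 1 = 0 := by
  simp [gaussianMoment, integral_id_gaussianReal]

lemma gaussianMoment_two : gaussianMoment 2 = 1 := by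
  have h := variance_id_gaussianReal (μ := 0) (v := 1)
  rw [variance_of_integral_eq_zero (by fun_prop) (by simp [integral_id_gaussianReal])] at h
  simpa [gaussianMoment] using h

instance isFiniteMeasure_bernoulliReal (p : ℝ) : IsFiniteMeasure (bernoulliReal p) := by
  unfold bernoulliReal; infer_instance

lemma isProbabilityMeasure_bernoulliReal {p : ℝ} (hp : p ∈ Set.Ioc (0 : ℝ) 1) :
    IsProbabilityMeasure (bernoulliReal p) := by
  constructor
  have h : p.toNNReal + (1 - p).toNNReal = 1 := by
    rw [← Real.toNNReal_add hp.1.le (by linarith [hp.2])]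
    simp
  simp only [bernoulliReal, Measure.add_apply, Measure.smul_apply, measure_univ]
  rw [← add_smul, h, one_smul]

lemma integrable_pow_bernoulliReal (p : ℝ) (k : ℕ) :
    Integrable (fun x : ℝ => x ^ k) (bernoulliReal p) := by
  unfold bernoulliReal
  exact ((integrable_dirac (by simp)).smul_measure_nnreal).add_measure
    ((integrable_dirac (by simp)).smul_measure_nnreal)

lemma integral_pow_bernoulliReal {p : ℝ} (hp : p ∈ Set.Ioc (0 : ℝ) 1) {k : ℕ} (hk : k ≠ 0) :
    ∫ x, x ^ k ∂bernoulliReal p = p := by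
  unfold bernoulliReal
  rw [integral_add_measure ((integrable_dirac (by simp)).smul_measure_nnreal)
    ((integrable_dirac (by simp)).smul_measure_nnreal), integral_smul_nnreal_measure,
    integral_smul_nnreal_measure, integral_dirac, integral_dirac]
  simp [hk, NNReal.smul_def, hp.1.le]

lemma sparseEntryMoment_of_two_le {N : ℕ} {p : ℝ} (hp : p ∈ Set.Ioc (0 : ℝ) 1)
    (hNp : 1 ≤ (N : ℝ) * p) {k : ℕ} (hk : 2 ≤ k) :
    sparseEntryMoment N p k
      = (Real.sqrt (N * p))⁻¹ ^ (k - 2) * (gaussianMoment k * (N : ℝ)⁻¹) := by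
  obtain ⟨k, rfl⟩ := Nat.exists_eq_add_of_le' hk
  have hs : (Real.sqrt (N * p))⁻¹ ^ 2 = (N * p)⁻¹ := by
    rw [inv_pow, Real.sq_sqrt (by linarith)]
  have hp0 := hp.1.ne'
  rw [sparseEntryMoment, integral_pow_bernoulliReal hp (by omega), pow_add, hs, mul_inv]
  simp only [Nat.add_sub_cancel]
  field_simp

lemma exists_momentBounds (L : ℕ) : ∃ G : ℝ, ∀ (N : ℕ) (p : ℝ), p ∈ Set.Ioc (0 : ℝ) 1 →
    1 ≤ (N : ℝ) * p → MomentBounds N (sparseEntryMoment N p) gaussianMoment L G := by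
  have hle : ∀ k ≤ L, |gaussianMoment k| ≤ 1 + ∑ k ∈ Finset.range (L + 1), |gaussianMoment k| :=
    fun k hk => by
      have := Finset.single_le_sum (f := fun k => |gaussianMoment k|) (fun _ _ => abs_nonneg _)
        (Finset.mem_range.2 (Nat.lt_succ_of_le hk))
      linarith
  refine ⟨1 + ∑ k ∈ Finset.range (L + 1), |gaussianMoment k|, fun N p hp hNp => ?_⟩
  have hsum : 0 ≤ ∑ k ∈ Finset.range (L + 1), |gaussianMoment k| :=
    Finset.sum_nonneg fun _ _ => abs_nonneg _
  have := isProbabilityMeasure_bernoulliReal hp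
  refine ⟨by simp [sparseEntryMoment, gaussianMoment_zero], ?_, ?_, gaussianMoment_zero,
    gaussianMoment_one, gaussianMoment_two, hle, by linarith⟩
  · rw [sparseEntryMoment_of_two_le hp hNp le_rfl, gaussianMoment_two]
    simp
  · intro k hk hkL
    rcases hk.eq_or_lt with rfl | hk
    · simp only [sparseEntryMoment, gaussianMoment_one]
      simp only [zero_mul, mul_zero, abs_zero]
      positivity
    · have h₁ : 1 ≤ Real.sqrt (N * p) := Real.one_le_sqrt.2 hNp
      have h₂ : (Real.sqrt (N * p))⁻¹ ^ (k - 2) ≤ 1 :=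
        pow_le_one₀ (by positivity) (inv_le_one_of_one_le₀ h₁)
      rw [sparseEntryMoment_of_two_le hp hNp hk, abs_mul, abs_mul, abs_of_nonneg (by positivity),
        abs_of_nonneg (a := (N : ℝ)⁻¹) (by positivity)]
      exact (mul_le_of_le_one_left (by positivity) h₂).trans (by gcongr; exact hle k hkL)

variable {d N : ℕ}

lemma isProbabilityMeasure_sparseMeasure {p : ℝ} (hp : p ∈ Set.Ioc (0 : ℝ) 1) :
    IsProbabilityMeasure (sparseMeasure d N p) := by
  have := isProbabilityMeasure_bernoulliReal hp
  unfold sparseMeasure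
  infer_instance

/-- A monomial in the entries of the sparse matrices and of the initial vector. -/
def sparseMonomial (p : ℝ) (E : List (Fin d × Fin N × Fin N)) (H : List (Fin N))
    (ω : SparseOmega d N) : ℝ :=
  (E.map fun e => sparseA p ω e.1 e.2.1 e.2.2).prod * (H.map ω.2.2).prod

lemma sparseMonomial_mul (p : ℝ) (E E' : List (Fin d × Fin N × Fin N)) (H H' : List (Fin N))
    (ω : SparseOmega d N) :
    sparseMonomial p E H ω * sparseMonomial p E' H' ω
      = sparseMonomial p (E ++ E') (H ++ H') ω := by
  simp only [sparseMonomial, List.map_append, List.prod_append]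
  ring

/-- The multiplicity of `a` in `l`. -/
def multiplicityIn {α : Type*} [DecidableEq α] (l : List α) (a : α) : ℕ := l.count a

lemma list_prod_map_eq {α : Type*} [Fintype α] [DecidableEq α] (f : α → ℝ) (l : List α) :
    (l.map f).prod = ∏ a, f a ^ multiplicityIn l a := by
  rw [Finset.prod_list_map_count]
  refine Finset.prod_subset (Finset.subset_univ _) fun a _ ha => ?_
  rw [List.count_eq_zero_of_not_mem (by simpa using ha), pow_zero]

lemma sparseMonomial_eq (p : ℝ) (E : List (Fin d × Fin N × Fin N)) (H : List (Fin N)) :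
    sparseMonomial p E H = fun ω =>
      (∏ c, ∏ i, ∏ j, (Real.sqrt (N * p))⁻¹ ^ multiplicityIn E (c, i, j)) *
        ((∏ c, ∏ i, ∏ j, ω.1 c i j ^ multiplicityIn E (c, i, j)) *
          ((∏ c, ∏ i, ∏ j, ω.2.1 c i j ^ multiplicityIn E (c, i, j)) * ∏ v, ω.2.2 v ^ multiplicityIn H v)) := by
  funext ω
  rw [sparseMonomial, list_prod_map_eq, list_prod_map_eq]
  simp only [sparseA, Matrix.smul_apply, Matrix.hadamard_apply, Matrix.of_apply, smul_eq_mul,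
    mul_pow, Finset.prod_mul_distrib, Fintype.prod_prod_type]
  ring

lemma integrable_matrices {ν : Measure ℝ} [IsFiniteMeasure ν]
    (hν : ∀ k : ℕ, Integrable (fun x : ℝ => x ^ k) ν) (m : Fin d → Fin N → Fin N → ℕ) :
    Integrable (fun x : Fin d → Fin N → Fin N → ℝ => ∏ c, ∏ i, ∏ j, x c i j ^ m c i j)
      (Measure.pi fun _ => Measure.pi fun _ => Measure.pi fun _ => ν) :=
  Integrable.fintype_prod (f := fun c (x : Fin N → Fin N → ℝ) => ∏ i, ∏ j, x i j ^ m c i j)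
    fun c => Integrable.fintype_prod (f := fun i (x : Fin N → ℝ) => ∏ j, x j ^ m c i j)
      fun i => Integrable.fintype_prod (f := fun j (x : ℝ) => x ^ m c i j) fun _ => hν _

lemma integral_matrices {ν : Measure ℝ} [IsFiniteMeasure ν] (m : Fin d → Fin N → Fin N → ℕ) :
    ∫ x : Fin d → Fin N → Fin N → ℝ, ∏ c, ∏ i, ∏ j, x c i j ^ m c i j
        ∂(Measure.pi fun _ => Measure.pi fun _ => Measure.pi fun _ => ν)
      = ∏ c, ∏ i, ∏ j, ∫ x, x ^ m c i j ∂ν := by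
  rw [integral_fintype_prod_eq_prod (fun c (x : Fin N → Fin N → ℝ) => ∏ i, ∏ j, x i j ^ m c i j)]
  refine Finset.prod_congr rfl fun c _ => ?_
  rw [integral_fintype_prod_eq_prod (fun i (x : Fin N → ℝ) => ∏ j, x j ^ m c i j)]
  refine Finset.prod_congr rfl fun i _ => ?_
  rw [integral_fintype_prod_eq_prod (fun j (x : ℝ) => x ^ m c i j)]

lemma integrable_sparseMonomial (p : ℝ) (E : List (Fin d × Fin N × Fin N)) (H : List (Fin N)) :
    Integrable (sparseMonomial p E H) (sparseMeasure d N p) := by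
  rw [sparseMonomial_eq]
  refine Integrable.const_mul ?_ _
  refine Integrable.mul_prod (f := fun x : Fin d → Fin N → Fin N → ℝ =>
    ∏ c, ∏ i, ∏ j, x c i j ^ multiplicityIn E (c, i, j))
    (g := fun y : (Fin d → Fin N → Fin N → ℝ) × (Fin N → ℝ) =>
      (∏ c, ∏ i, ∏ j, y.1 c i j ^ multiplicityIn E (c, i, j)) * ∏ v, y.2 v ^ multiplicityIn H v)
    (integrable_matrices integrable_pow_gaussianReal fun c i j => multiplicityIn E (c, i, j)) ?_
  refine Integrable.mul_prod (f := fun x : Fin d → Fin N → Fin N → ℝ =>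
    ∏ c, ∏ i, ∏ j, x c i j ^ multiplicityIn E (c, i, j)) (g := fun x : Fin N → ℝ => ∏ v, x v ^ multiplicityIn H v)
    (integrable_matrices (integrable_pow_bernoulliReal p) fun c i j => multiplicityIn E (c, i, j)) ?_
  exact Integrable.fintype_prod (f := fun v (x : ℝ) => x ^ multiplicityIn H v)
    fun v => integrable_pow_gaussianReal _

lemma integral_sparseMonomial (p : ℝ) (E : List (Fin d × Fin N × Fin N)) (H : List (Fin N)) :
    ∫ ω, sparseMonomial p E H ω ∂sparseMeasure d N p
      = mixedMoment (sparseEntryMoment N p) gaussianMoment E H := by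
  rw [sparseMonomial_eq, integral_const_mul, sparseMeasure,
    integral_prod_mul (fun x : Fin d → Fin N → Fin N → ℝ =>
      ∏ c, ∏ i, ∏ j, x c i j ^ multiplicityIn E (c, i, j))
      (fun y : (Fin d → Fin N → Fin N → ℝ) × (Fin N → ℝ) =>
        (∏ c, ∏ i, ∏ j, y.1 c i j ^ multiplicityIn E (c, i, j)) * ∏ v, y.2 v ^ multiplicityIn H v),
    integral_prod_mul (fun x : Fin d → Fin N → Fin N → ℝ =>
      ∏ c, ∏ i, ∏ j, x c i j ^ multiplicityIn E (c, i, j)) (fun x : Fin N → ℝ => ∏ v, x v ^ multiplicityIn H v),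
    integral_matrices (ν := gaussianReal 0 1) fun c i j => multiplicityIn E (c, i, j),
    integral_matrices (ν := bernoulliReal p) fun c i j => multiplicityIn E (c, i, j),
    integral_fintype_prod_eq_prod (fun v (x : ℝ) => x ^ multiplicityIn H v)]
  simp only [mixedMoment, countProd, sparseEntryMoment, gaussianMoment, Finset.prod_mul_distrib,
    Fintype.prod_prod_type, multiplicityIn]
  ring

lemma sparseFeature_apply (p : ℝ) (I : List (Fin d)) (ω : SparseOmega d N) (v : Fin N) :
    sparseFeature p I ω v = ∑ w ∈ walks I,
      ((walkEdges v w).map fun e => sparseA p ω e.1 e.2.1 e.2.2).prod * ω.2.2 (walkEnd v w) := by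
  induction I generalizing v with
  | nil => simp [sparseFeature, wordProd, walks, walkEdges, walkEnd]
  | cons c I ih =>
    have : sparseFeature p (c :: I) ω v = ∑ x, sparseA p ω c v x * sparseFeature p I ω x := by
      simp only [sparseFeature, wordProd, List.map_cons, List.prod_cons, ← Matrix.mulVec_mulVec]
      rfl
    rw [this, sum_walks_cons]
    simp only [ih, Finset.mul_sum, walkEdges, walkEnd, List.map_cons, List.prod_cons, mul_assoc]

lemma sparseFeature_dotProduct (p : ℝ) (I J : List (Fin d)) (ω : SparseOmega d N) :
    sparseFeature p I ω ⬝ᵥ sparseFeature p J ω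
      = ∑ s ∈ walkPairs I J, sparseMonomial p (pairEdges s) (pairEnds s) ω := by
  simp only [dotProduct, sparseFeature_apply, walkPairs, Finset.sum_product, Finset.sum_mul_sum]
  refine Finset.sum_congr rfl fun v _ => Finset.sum_congr rfl fun w _ =>
    Finset.sum_congr rfl fun w' _ => ?_
  simp only [sparseMonomial, pairEdges, pairEnds, List.map_append, List.prod_append, List.map_cons,
    List.map_nil, List.prod_cons, List.prod_nil]
  ring

/-- The mean square deviation of a normalised Gram entry expanded into monomials. -/
lemma deviation_sq_eq (p δ : ℝ) (I J : List (Fin d)) (ω : SparseOmega d N) :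
    ((N : ℝ)⁻¹ * (sparseFeature p I ω ⬝ᵥ sparseFeature p J ω) - δ) ^ 2
      = (N : ℝ)⁻¹ ^ 2 * ∑ s ∈ walkPairs I J, ∑ t ∈ walkPairs I J,
          sparseMonomial p (pairEdges s ++ pairEdges t) (pairEnds s ++ pairEnds t) ω
        - 2 * δ * ((N : ℝ)⁻¹ * ∑ s ∈ walkPairs I J, sparseMonomial p (pairEdges s) (pairEnds s) ω)
        + δ ^ 2 := by
  simp only [← sparseMonomial_mul, ← Finset.sum_mul_sum, sparseFeature_dotProduct]
  ring

lemma integrable_deviation_sq {p : ℝ} (hp : p ∈ Set.Ioc (0 : ℝ) 1) (δ : ℝ) (I J : List (Fin d)) :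
    Integrable (fun ω => ((N : ℝ)⁻¹ * (sparseFeature p I ω ⬝ᵥ sparseFeature p J ω) - δ) ^ 2)
      (sparseMeasure d N p) := by
  have := isProbabilityMeasure_sparseMeasure (d := d) (N := N) hp
  simp only [deviation_sq_eq]
  refine ((Integrable.const_mul ?_ _).sub (((Integrable.const_mul ?_ _)).const_mul _)).add
    (integrable_const _)
  · exact integrable_finsetSum _ fun s _ => integrable_finsetSum _ fun t _ =>
      integrable_sparseMonomial p _ _
  · exact integrable_finsetSum _ fun s _ => integrable_sparseMonomial p _ _

lemma integral_deviation_sq {p : ℝ} (hp : p ∈ Set.Ioc (0 : ℝ) 1) (δ : ℝ) (I J : List (Fin d)) :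
    ∫ ω, ((N : ℝ)⁻¹ * (sparseFeature p I ω ⬝ᵥ sparseFeature p J ω) - δ) ^ 2 ∂sparseMeasure d N p
      = (N : ℝ)⁻¹ ^ 2 * ∑ s ∈ walkPairs (V := Fin N) I J, ∑ t ∈ walkPairs (V := Fin N) I J,
          mixedMoment (sparseEntryMoment N p) gaussianMoment
            (pairEdges s ++ pairEdges t) (pairEnds s ++ pairEnds t)
        - 2 * δ * ((N : ℝ)⁻¹ * ∑ s ∈ walkPairs (V := Fin N) I J,
          mixedMoment (sparseEntryMoment N p) gaussianMoment (pairEdges s) (pairEnds s))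
        + δ ^ 2 := by
  have := isProbabilityMeasure_sparseMeasure (d := d) (N := N) hp
  have h₂ : Integrable (fun ω => ∑ s ∈ walkPairs I J, ∑ t ∈ walkPairs I J,
      sparseMonomial p (pairEdges s ++ pairEdges t) (pairEnds s ++ pairEnds t) ω)
      (sparseMeasure d N p) := integrable_finsetSum _ fun s _ => integrable_finsetSum _ fun t _ =>
        integrable_sparseMonomial p _ _
  have h₁ : Integrable (fun ω => ∑ s ∈ walkPairs I J,
      sparseMonomial p (pairEdges s) (pairEnds s) ω) (sparseMeasure d N p) :=
    integrable_finsetSum _ fun s _ => integrable_sparseMonomial p _ _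
  have h₃ : Integrable (fun ω => (N : ℝ)⁻¹ ^ 2 * ∑ s ∈ walkPairs I J, ∑ t ∈ walkPairs I J,
        sparseMonomial p (pairEdges s ++ pairEdges t) (pairEnds s ++ pairEnds t) ω
      - 2 * δ * ((N : ℝ)⁻¹ * ∑ s ∈ walkPairs I J, sparseMonomial p (pairEdges s) (pairEnds s) ω))
      (sparseMeasure d N p) := (h₂.const_mul _).sub ((h₁.const_mul _).const_mul _)
  simp only [deviation_sq_eq]
  rw [integral_add h₃ (integrable_const _),
    integral_sub (h₂.const_mul _) ((h₁.const_mul _).const_mul _), integral_const_mul,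
    integral_const_mul, integral_const_mul, integral_const,
    integral_finsetSum _ fun s _ => integrable_sparseMonomial p (pairEdges s) (pairEnds s),
    integral_finsetSum _ fun s _ => integrable_finsetSum _ fun t _ => integrable_sparseMonomial p
      (pairEdges s ++ pairEdges t) (pairEnds s ++ pairEnds t)]
  simp only [integral_finsetSum _ fun t _ => integrable_sparseMonomial p (pairEdges _ ++ pairEdges t)
    (pairEnds _ ++ pairEnds t), integral_sparseMonomial, probReal_univ, one_smul]

/-- The mean square deviation of a normalised Gram entry is `O(1/N)`. -/
lemma exists_deviation_bound (I J : List (Fin d)) :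
    ∃ K : ℝ, ∀ (N : ℕ) (p : ℝ), p ∈ Set.Ioc (0 : ℝ) 1 → 1 ≤ (N : ℝ) * p →
      ∫ ω, ((N : ℝ)⁻¹ * (sparseFeature p I ω ⬝ᵥ sparseFeature p J ω) - wordDelta I J) ^ 2
        ∂sparseMeasure d N p ≤ K * (N : ℝ)⁻¹ := by
  obtain ⟨G, hG⟩ := exists_momentBounds (2 * (1 + I.length + J.length) + 2)
  refine ⟨2 * G ^ (4 * (2 * (1 + I.length + J.length) + 2))
      * ((1 + ↑(2 * (1 + I.length + J.length) + 2)) ^ (1 + I.length + J.length)) ^ 2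
    + ((G ^ (2 * (2 * (1 + I.length + J.length) + 2)) + 1)
      * (1 + ↑(2 * (1 + I.length + J.length) + 2)) ^ (1 + I.length + J.length)) ^ 2,
    fun N p hp hNp => ?_⟩
  have hN : N ≠ 0 := by
    rintro rfl
    norm_num at hNp
  have : NeZero N := ⟨hN⟩
  have h := mixedMoment_deviation_le (V := Fin N) I J (by simpa using hG N p hp hNp) le_rfl
  rw [integral_deviation_sq hp]
  simpa only [Fintype.card_fin, wordDelta] using h

end Probability

/-- **High-probability almost-orthonormality for the sparse model.**  Fix `d ≥ 1` and
sparsity parameters `p_N ∈ (0,1]` with `N⬝p_N → ∞`.  For every `ε, δ ∈ (0,1)` and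
every finite set `𝒲` of words over `{1,…,d}` there is an `N₀` such that for all
`N ≥ N₀`,
`P(|(1/N)⟨A_I h₀, A_J h₀⟩ - δ_{I,J}| ≤ ε for all I, J ∈ 𝒲) ≥ 1 - δ`. -/
theorem sparse_high_probability_orthonormality (d : ℕ) (hd : 1 ≤ d)
    (p : ℕ → ℝ) (hp : ∀ N, p N ∈ Set.Ioc (0 : ℝ) 1)
    (hNp : Tendsto (fun N : ℕ => (N : ℝ) * p N) atTop atTop)
    (ε δ : ℝ) (hε : ε ∈ Set.Ioo (0 : ℝ) 1) (hδ : δ ∈ Set.Ioo (0 : ℝ) 1)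
    (𝒲 : Finset (List (Fin d))) :
    ∃ N₀ : ℕ, ∀ N : ℕ, N₀ ≤ N →
      sparseMeasure d N (p N)
          {ω | ∀ I ∈ 𝒲, ∀ J ∈ 𝒲,
            |((N : ℕ) : ℝ)⁻¹ * (sparseFeature (p N) I ω ⬝ᵥ sparseFeature (p N) J ω)
              - wordDelta I J| ≤ ε}
        ≥ ENNReal.ofReal (1 - δ) := by

  obtain ⟨hε0, -⟩ := hε
  choose K hK using fun I J : List (Fin d) => exists_deviation_bound I J
  set S := ∑ I ∈ 𝒲, ∑ J ∈ 𝒲, K I J / ε ^ 2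
  have hlim : Tendsto (fun N : ℕ => S * (N : ℝ)⁻¹) atTop (nhds 0) := by
    simpa using (tendsto_inv_atTop_zero.comp tendsto_natCast_atTop_atTop).const_mul S
  obtain ⟨N₀, hN₀⟩ := Filter.eventually_atTop.1
    ((hNp.eventually_ge_atTop 1).and (hlim.eventually_le_const hδ.1))
  refine ⟨N₀, fun N hN => ?_⟩
  obtain ⟨hNp1, hS⟩ := hN₀ N hN
  set P := sparseMeasure d N (p N)
  have hP : IsProbabilityMeasure P := isProbabilityMeasure_sparseMeasure (hp N)
  set X : List (Fin d) → List (Fin d) → SparseOmega d N → ℝ := fun I J ω =>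
    (N : ℝ)⁻¹ * (sparseFeature (p N) I ω ⬝ᵥ sparseFeature (p N) J ω) - wordDelta I J with hX
  have hcheb : ∀ I J, P {ω | ε ^ 2 ≤ X I J ω ^ 2} ≤ ENNReal.ofReal (K I J / ε ^ 2 * (N : ℝ)⁻¹) := by
    intro I J
    rw [← ofReal_measureReal]
    refine ENNReal.ofReal_le_ofReal ?_
    have h₁ := mul_meas_ge_le_integral_of_nonneg (μ := P) (f := fun ω => X I J ω ^ 2)
      (Filter.Eventually.of_forall fun ω => sq_nonneg _)
      (integrable_deviation_sq (hp N) (wordDelta I J) I J) (ε ^ 2)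
    have h₂ := h₁.trans (hK I J N (p N) (hp N) hNp1)
    rw [div_mul_eq_mul_div, le_div_iff₀' (by positivity)]
    exact h₂
  have hKnonneg : ∀ I J, 0 ≤ K I J / ε ^ 2 * (N : ℝ)⁻¹ := fun I J => by
    have := (integral_nonneg fun ω => sq_nonneg _).trans (hK I J N (p N) (hp N) hNp1)
    rw [div_mul_eq_mul_div]
    positivity
  set good : Set (SparseOmega d N) := {ω | ∀ I ∈ 𝒲, ∀ J ∈ 𝒲, |X I J ω| ≤ ε}
  have hcover : (Set.univ : Set (SparseOmega d N))
      ⊆ good ∪ ⋃ I ∈ 𝒲, ⋃ J ∈ 𝒲, {ω | ε ^ 2 ≤ X I J ω ^ 2} := by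
    intro ω _
    by_contra hω
    simp only [Set.mem_union, Set.mem_iUnion, Set.mem_ofPred_eq, not_or, not_exists, not_le] at hω
    exact hω.1 fun I hI J hJ => (abs_lt_of_sq_lt_sq (hω.2 I hI J hJ) hε0.le).le
  have hbad : P (⋃ I ∈ 𝒲, ⋃ J ∈ 𝒲, {ω | ε ^ 2 ≤ X I J ω ^ 2}) ≤ ENNReal.ofReal δ := by
    calc _ ≤ ∑ I ∈ 𝒲, ∑ J ∈ 𝒲, ENNReal.ofReal (K I J / ε ^ 2 * (N : ℝ)⁻¹) :=
          (measure_biUnion_finset_le _ _).trans (Finset.sum_le_sum fun I _ =>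
            (measure_biUnion_finset_le _ _).trans (Finset.sum_le_sum fun J _ => hcheb I J))
      _ = ENNReal.ofReal (S * (N : ℝ)⁻¹) := by
          simp only [S, Finset.sum_mul]
          rw [ENNReal.ofReal_sum_of_nonneg fun I _ => Finset.sum_nonneg fun J _ => hKnonneg I J]
          refine Finset.sum_congr rfl fun I _ => ?_
          rw [ENNReal.ofReal_sum_of_nonneg fun J _ => hKnonneg I J]
      _ ≤ ENNReal.ofReal δ := ENNReal.ofReal_le_ofReal hS
  have htotal : 1 ≤ P good + ENNReal.ofReal δ := by
    rw [← measure_univ (μ := P)]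
    exact (measure_mono hcover).trans ((measure_union_le _ _).trans (by gcongr))
  rw [ge_iff_le, ENNReal.ofReal_sub _ hδ.1.le, ENNReal.ofReal_one]
  exact tsub_le_iff_right.2 htotal

end
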